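/- arXiv:math/9905084 — 2 statements merged into one kernel-verified Lean document; each statement's English description precedes it below -/
import Mathlib

section
/- For every real y > 1, (1/π) ∫_{-1}^{1} (2y/(y² - x²)) √(1 - x²) dx = 2y - 2√(y² - 1). -/
open Real

theorem stmt6 (y : ℝ) (hy : 1 < y) :
    (1 / π) * ∫ x in (-1 : ℝ)..1, 2 * y / (y ^ 2 - x ^ 2) * Real.sqrt (1 - x ^ 2)
      = 2 * y - 2 * Real.sqrt (y ^ 2 - 1) := by
  have hs2 : Real.sqrt (y ^ 2 - 1) ^ 2 = y ^ 2 - 1 := Real.sq_sqrt (by nlinarith)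
  have hs0 : 0 < Real.sqrt (y ^ 2 - 1) := Real.sqrt_pos.mpr (by nlinarith)
  set s := Real.sqrt (y ^ 2 - 1) with hs
  have hpos : ∀ x ∈ Set.Icc (-1 : ℝ) 1, 0 < y ^ 2 - x ^ 2 := by
    intro x hx
    nlinarith [hx.1, hx.2]
  have key := intervalIntegral.integral_eq_sub_of_hasDerivAt_of_le
    (f := fun x : ℝ => 2 * y * arcsin x - 2 * s * arcsin (s * x / Real.sqrt (y ^ 2 - x ^ 2)))
    (f' := fun x : ℝ => 2 * y / (y ^ 2 - x ^ 2) * Real.sqrt (1 - x ^ 2))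
    (a := -1) (b := 1) (by norm_num) ?_ ?_ ?_
  · rw [key]
    have h1 : (s * 1 / Real.sqrt (y ^ 2 - 1 ^ 2)) = 1 := by
      rw [one_pow, ← hs]; field_simp
    have h2 : (s * (-1) / Real.sqrt (y ^ 2 - (-1) ^ 2)) = -1 := by
      rw [neg_one_sq, ← hs]; field_simp
    simp only [h1, h2, arcsin_one, arcsin_neg]
    field_simp
    ring
  · have : ∀ x ∈ Set.Icc (-1 : ℝ) 1, Real.sqrt (y ^ 2 - x ^ 2) ≠ 0 := fun x hx =>
      (Real.sqrt_pos.mpr (hpos x hx)).ne'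
    have h3 : ContinuousOn (fun x : ℝ => s * x / Real.sqrt (y ^ 2 - x ^ 2)) (Set.Icc (-1) 1) :=
      ContinuousOn.div (by fun_prop) (by fun_prop) this
    exact (continuous_const.mul continuous_arcsin).continuousOn.sub
      (continuousOn_const.mul (continuous_arcsin.comp_continuousOn h3))
  · intro x hx
    have hp := hpos x ⟨hx.1.le, hx.2.le⟩
    have hq : 0 < 1 - x ^ 2 := by nlinarith [hx.1, hx.2]
    have hr0 := Real.sqrt_pos.mpr hp
    have hr2 := Real.sq_sqrt hp.le
    have hc0 := Real.sqrt_pos.mpr hq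
    have hc2 := Real.sq_sqrt hq.le
    have hd0 : HasDerivAt (fun x : ℝ => y ^ 2 - x ^ 2) (-(2 * x)) x := by
      simpa using (hasDerivAt_pow 2 x).const_sub (y ^ 2)
    have hd1 := hd0.sqrt hp.ne'
    have hd2 := ((hasDerivAt_id x).const_mul s).div hd1 hr0.ne'
    set r := Real.sqrt (y ^ 2 - x ^ 2) with hr
    set c := Real.sqrt (1 - x ^ 2) with hc
    have hu : 1 - (s * x / r) ^ 2 = (y * c / r) ^ 2 := by
      field_simp
      rw [hr2, hs2, hc2]; ring
    have hyc : 0 < y * c / r := by positivity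
    have hlt : (s * x / r) ^ 2 < 1 := by nlinarith [pow_pos hyc 2]
    have hne := abs_lt.mp ((sq_lt_one_iff_abs_lt_one _).mp hlt)
    have hd3 := (hasDerivAt_arcsin hne.1.ne' hne.2.ne).comp x hd2
    have hd4 := ((hasDerivAt_arcsin hx.1.ne' hx.2.ne).const_mul (2 * y)).sub
      (hd3.const_mul (2 * s))
    refine hd4.congr_deriv ?_
    rw [hu, Real.sqrt_sq hyc.le, ← hc, ← hr2]
    simp only [id]
    field_simp
    have e1 : r ^ 2 = s ^ 2 + c ^ 2 := by rw [hr2, hs2, hc2]; ring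
    have e2 : r ^ 2 + x ^ 2 = y ^ 2 := by rw [hr2]; ring
    linear_combination y ^ 2 * e1 - s ^ 2 * e2
  · apply ContinuousOn.intervalIntegrable
    rw [Set.uIcc_of_le (by norm_num)]
    exact (ContinuousOn.div (by fun_prop) (by fun_prop) (fun x hx => (hpos x hx).ne')).mul
      (by fun_prop)
end

section
/- The number of signed involutions in S^{□}_{n,m₊,m₋} equals (2n + m₊ + m₋)!/(n! · m₊! · m₋!). -/
open Nat

/-- Unsigned involution `g` together with a `g`-invariant sign. -/
abbrev SInv (α : Type) (p m : ℕ) : Type :=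
  {y : (α → α) × (α → Bool) // (∀ x, y.1 (y.1 x) = x) ∧ (∀ x, y.2 (y.1 x) = y.2 x) ∧
    Nat.card {x : α // y.1 x = x ∧ y.2 x = true} = p ∧
    Nat.card {x : α // y.1 x = x ∧ y.2 x = false} = m}

abbrev PtS {α : Type} (y : (α → α) × (α → Bool)) : Type := {x : α // y.1 x = x ∧ y.2 x = true}
abbrev MtS {α : Type} (y : (α → α) × (α → Bool)) : Type := {x : α // y.1 x = x ∧ y.2 x = false}
abbrev FtS {α : Type} [LinearOrder α] (y : (α → α) × (α → Bool)) : Type :=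
  {x : α // y.1 x ≠ x ∧ (x < y.1 x ↔ y.2 x = true)}

def decF {α : Type} [LinearOrder α] (y : (α → α) × (α → Bool)) :
    PtS y ⊕ MtS y ⊕ FtS y ⊕ FtS y → α :=
  Sum.elim Subtype.val (Sum.elim Subtype.val (Sum.elim Subtype.val (fun x => y.1 x.val)))

theorem decF_bij {α : Type} [LinearOrder α] (y : (α → α) × (α → Bool))
    (h1 : ∀ x, y.1 (y.1 x) = x) (h2 : ∀ x, y.2 (y.1 x) = y.2 x) :
    Function.Bijective (decF y) := by
  have key : ∀ x, (y.1 x ≠ x ∧ (x < y.1 x ↔ y.2 x = true)) →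
      ¬ (y.1 (y.1 x) ≠ y.1 x ∧ (y.1 x < y.1 (y.1 x) ↔ y.2 (y.1 x) = true)) := by
    intro x hx hx'
    rw [h1, h2] at hx'
    rcases lt_trichotomy x (y.1 x) with h | h | h
    · have := hx.2.1 h
      exact absurd (hx'.2.2 this) (not_lt.2 h.le)
    · exact hx.1 h.symm
    · have := hx'.2.1 h
      exact absurd (hx.2.2 this) (not_lt.2 h.le)
  constructor
  · rintro (⟨a, ha⟩ | ⟨a, ha⟩ | ⟨a, ha⟩ | ⟨a, ha⟩) (⟨b, hb⟩ | ⟨b, hb⟩ | ⟨b, hb⟩ | ⟨b, hb⟩) hab <;>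
      simp only [decF, Sum.elim_inl, Sum.elim_inr] at hab
    · subst hab; rfl
    · subst hab; clear key h1 h2; grind
    · subst hab; clear key h1 h2; grind
    · subst hab; exact absurd ((h1 b).symm.trans ha.1).symm hb.1
    · subst hab; clear key h1 h2; grind
    · subst hab; rfl
    · subst hab; clear key h1 h2; grind
    · subst hab; exact absurd ((h1 b).symm.trans ha.1).symm hb.1
    · subst hab; clear key h1 h2; grind
    · subst hab; clear key h1 h2; grind
    · subst hab; rfl
    · subst hab; exact absurd ha (key _ hb)
    · subst hab; exact absurd ((h1 a).symm.trans hb.1).symm ha.1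
    · subst hab; exact absurd ((h1 a).symm.trans hb.1).symm ha.1
    · subst hab; exact absurd hb (key _ ha)
    · have : a = b := by rw [← h1 a, hab, h1]
      subst this; rfl
  · intro x
    by_cases hx : y.1 x = x
    · cases hs : y.2 x
      · exact ⟨Sum.inr (Sum.inl ⟨x, hx, hs⟩), rfl⟩
      · exact ⟨Sum.inl ⟨x, hx, hs⟩, rfl⟩
    · by_cases hF : (x < y.1 x ↔ y.2 x = true)
      · exact ⟨Sum.inr (Sum.inr (Sum.inl ⟨x, hx, hF⟩)), rfl⟩
      · refine ⟨Sum.inr (Sum.inr (Sum.inr ⟨y.1 x, ?_, ?_⟩)), ?_⟩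
        · rw [h1]; exact fun h => hx h.symm
        · rw [h1, h2]
          rcases lt_or_gt_of_ne hx with h | h
          · have h' := not_lt.2 h.le
            simp only [h, true_iff]; simpa [h'] using hF
          · have h' := not_lt.2 h.le
            simp only [h', false_iff]; simpa [h] using hF
        · exact h1 x

noncomputable def decE {α : Type} [LinearOrder α] {p m : ℕ} (y : SInv α p m) :
    PtS y.1 ⊕ MtS y.1 ⊕ FtS y.1 ⊕ FtS y.1 ≃ α :=
  Equiv.ofBijective (decF y.1) (decF_bij y.1 y.2.1 y.2.2.1)

abbrev TT (n p m : ℕ) : Type := Fin p ⊕ Fin m ⊕ Fin n ⊕ Fin n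

def tauT {n p m : ℕ} : TT n p m → TT n p m
  | .inl i => .inl i
  | .inr (.inl i) => .inr (.inl i)
  | .inr (.inr (.inl i)) => .inr (.inr (.inr i))
  | .inr (.inr (.inr i)) => .inr (.inr (.inl i))

def sgT {α : Type} [LinearOrder α] {n p m : ℕ} (e : TT n p m → α) : TT n p m → Bool
  | .inl _ => true
  | .inr (.inl _) => false
  | .inr (.inr (.inl i)) => decide (e (.inr (.inr (.inl i))) < e (.inr (.inr (.inr i))))
  | .inr (.inr (.inr i)) => decide (e (.inr (.inr (.inl i))) < e (.inr (.inr (.inr i))))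

abbrev LabS (α : Type) [LinearOrder α] (n p m : ℕ) : Type :=
  Σ y : SInv α p m, (Fin p ≃ PtS y.1) × (Fin m ≃ MtS y.1) × (Fin n ≃ FtS y.1)

noncomputable def thetaE {α : Type} [LinearOrder α] {n p m : ℕ} (z : LabS α n p m) :
    TT n p m ≃ α :=
  (Equiv.sumCongr z.2.1 (Equiv.sumCongr z.2.2.1 (Equiv.sumCongr z.2.2.2 z.2.2.2))).trans (decE z.1)

theorem thetaE_g {α : Type} [LinearOrder α] {n p m : ℕ} (z : LabS α n p m) (t : TT n p m) :
    z.1.1.1 (thetaE z t) = thetaE z (tauT t) := by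
  rcases t with i | i | i | i
  · exact (z.2.1 i).2.1
  · exact (z.2.2.1 i).2.1
  · rfl
  · exact z.1.2.1 _

theorem thetaE_s {α : Type} [LinearOrder α] {n p m : ℕ} (z : LabS α n p m) (t : TT n p m) :
    z.1.1.2 (thetaE z t) = sgT (thetaE z) t := by
  have h : ∀ i, z.1.1.2 (z.2.2.2 i).1 = decide ((z.2.2.2 i).1 < z.1.1.1 (z.2.2.2 i).1) := by
    intro i
    have := (z.2.2.2 i).2.2
    rw [Bool.eq_iff_iff, ← this]; simp
  rcases t with i | i | i | i
  · exact (z.2.1 i).2.2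
  · exact (z.2.2.1 i).2.2
  · exact h i
  · exact (z.1.2.2.1 _).trans (h i)

theorem thetaE_inj {α : Type} [LinearOrder α] {n p m : ℕ} :
    Function.Injective (thetaE : LabS α n p m → (TT n p m ≃ α)) := by
  intro z z' h
  have hy : z.1 = z'.1 := by
    apply Subtype.ext
    apply Prod.ext
    · funext x
      obtain ⟨t, rfl⟩ := (thetaE z).surjective x
      rw [thetaE_g, h, thetaE_g]
    · funext x
      obtain ⟨t, rfl⟩ := (thetaE z).surjective x
      rw [thetaE_s, h, thetaE_s]
  obtain ⟨y, a, b, c⟩ := z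
  obtain ⟨y', a', b', c'⟩ := z'
  obtain rfl : y = y' := hy
  have ha : a = a' := by
    ext i
    exact congrArg (fun e : TT n p m ≃ α => e (.inl i)) h
  have hb : b = b' := by
    ext i
    exact congrArg (fun e : TT n p m ≃ α => e (.inr (.inl i))) h
  have hc : c = c' := by
    ext i
    exact congrArg (fun e : TT n p m ≃ α => e (.inr (.inr (.inl i)))) h
  subst ha hb hc
  rfl

theorem thetaE_surj {α : Type} [LinearOrder α] {n p m : ℕ} :
    Function.Surjective (thetaE : LabS α n p m → (TT n p m ≃ α)) := by
  intro e
  let y : (α → α) × (α → Bool) := (fun x => e (tauT (e.symm x)), fun x => sgT e (e.symm x))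
  have hyg : ∀ t, y.1 (e t) = e (tauT t) := fun t => by simp [y]
  have hys : ∀ t, y.2 (e t) = sgT e t := fun t => by simp [y]
  have h1 : ∀ x, y.1 (y.1 x) = x := by
    intro x
    obtain ⟨t, rfl⟩ := e.surjective x
    rw [hyg t, hyg (tauT t)]
    rcases t with i | i | i | i <;> rfl
  have h2 : ∀ x, y.2 (y.1 x) = y.2 x := by
    intro x
    obtain ⟨t, rfl⟩ := e.surjective x
    rw [hyg t, hys (tauT t), hys t]
    rcases t with i | i | i | i <;> rfl
  let a : Fin p ≃ PtS y := Equiv.ofBijective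
    (fun i => ⟨e (.inl i), by rw [hyg]; rfl, by rw [hys]; rfl⟩) (by
      constructor
      · intro i j hij
        simpa using hij
      · rintro ⟨x, hx⟩
        obtain ⟨t, rfl⟩ := e.surjective x
        rw [hyg, hys, e.apply_eq_iff_eq] at hx
        rcases t with i | i | i | i
        · exact ⟨i, rfl⟩
        all_goals simp [tauT, sgT] at hx)
  let b : Fin m ≃ MtS y := Equiv.ofBijective
    (fun i => ⟨e (.inr (.inl i)), by rw [hyg]; rfl, by rw [hys]; rfl⟩) (by
      constructor
      · intro i j hij
        simpa using hij
      · rintro ⟨x, hx⟩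
        obtain ⟨t, rfl⟩ := e.surjective x
        rw [hyg, hys, e.apply_eq_iff_eq] at hx
        rcases t with i | i | i | i
        · simp [tauT, sgT] at hx
        · exact ⟨i, rfl⟩
        all_goals simp [tauT, sgT] at hx)
  let c : Fin n ≃ FtS y := Equiv.ofBijective
    (fun i => ⟨e (.inr (.inr (.inl i))), by rw [hyg]; simp [tauT],
        by rw [hyg, hys]; simp [tauT, sgT]⟩) (by
      constructor
      · intro i j hij
        simpa using hij
      · rintro ⟨x, hx⟩
        obtain ⟨t, rfl⟩ := e.surjective x
        rw [hyg, hys, Ne, e.apply_eq_iff_eq] at hx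
        rcases t with i | i | i | i
        · simp [tauT] at hx
        · simp [tauT] at hx
        · exact ⟨i, rfl⟩
        · exfalso
          have hne : e (.inr (.inr (.inl i))) ≠ e (.inr (.inr (.inr i))) := by simp
          simp only [tauT, sgT, decide_eq_true_eq] at hx
          rcases lt_or_gt_of_ne hne with h | h
          · exact absurd (hx.2.2 h) (not_lt.2 h.le)
          · exact absurd (hx.2.1 h) (not_lt.2 h.le))
  refine ⟨⟨⟨y, h1, h2, ?_, ?_⟩, a, b, c⟩, ?_⟩
  · simpa using (Nat.card_congr a).symm
  · simpa using (Nat.card_congr b).symm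
  · ext t
    rcases t with i | i | i | i
    · rfl
    · rfl
    · rfl
    · exact hyg (.inr (.inr (.inl i)))

theorem card_equiv_fin {β : Type} [Finite β] (k : ℕ) (h : Nat.card β = k) :
    Nat.card (Fin k ≃ β) = k ! := by
  classical
  have := Fintype.ofFinite β
  subst h
  rw [Nat.card_eq_fintype_card (α := (Fin (Nat.card β) ≃ β)),
    Fintype.card_equiv (Finite.equivFin β).symm, Fintype.card_fin]

theorem card_SInv {α : Type} [LinearOrder α] [Finite α] (n p m : ℕ)
    (hα : Nat.card α = 2 * n + p + m) :
    Nat.card (SInv α p m) * (n ! * p ! * m !) = (2 * n + p + m)! := by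
  classical
  have := Fintype.ofFinite α
  have e1 : Nat.card (LabS α n p m) = Nat.card (TT n p m ≃ α) :=
    Nat.card_congr (Equiv.ofBijective _ ⟨thetaE_inj, thetaE_surj⟩)
  have hT : Nat.card (TT n p m) = 2 * n + p + m := by
    simp; ring
  have e2 : Nat.card (TT n p m ≃ α) = (2 * n + p + m)! := by
    rw [Nat.card_congr (Equiv.equivCongr (Finite.equivFinOfCardEq hT) (Equiv.refl α)),
      card_equiv_fin _ hα]
  have := Fintype.ofFinite (SInv α p m)
  rw [← e2, ← e1, Nat.card_sigma]
  have h3 : ∀ y : SInv α p m, Nat.card ((Fin p ≃ PtS y.1) × (Fin m ≃ MtS y.1) × (Fin n ≃ FtS y.1))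
      = n ! * p ! * m ! := by
    intro y
    have hF : Nat.card (FtS y.1) = n := by
      have h := Nat.card_congr (decE y)
      rw [Nat.card_sum, Nat.card_sum, Nat.card_sum, hα] at h
      have hp : Nat.card (PtS y.1) = p := y.2.2.2.1
      have hm : Nat.card (MtS y.1) = m := y.2.2.2.2
      omega
    rw [Nat.card_prod, Nat.card_prod, card_equiv_fin _ y.2.2.2.1, card_equiv_fin _ y.2.2.2.2,
      card_equiv_fin _ hF]
    ring
  rw [Finset.sum_congr rfl (fun y _ => h3 y), Finset.sum_const, Finset.card_univ,
    Nat.card_eq_fintype_card, smul_eq_mul]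

abbrev PosI (N : ℕ) : Type := {x : ℤ // 0 < x ∧ x ≤ (N : ℤ)}

theorem card_PosI (N : ℕ) : Nat.card (PosI N) = N := by
  have : Nat.card (PosI N) = Nat.card (Finset.Ioc (0 : ℤ) N) :=
    Nat.card_congr (Equiv.subtypeEquivRight (by simp))
  rw [this, Nat.card_eq_fintype_card, Fintype.card_coe, Int.card_Ioc]; simp

instance finite_PosI (N : ℕ) : Finite (PosI N) :=
  Finite.of_equiv (Finset.Ioc (0 : ℤ) N) (Equiv.subtypeEquivRight (by simp))

theorem card_double (N : ℕ) (Q : ℤ → Prop) (hQ : ∀ x, Q (-x) ↔ Q x) :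
    Nat.card {x : ℤ // x ≠ 0 ∧ |x| ≤ (N : ℤ) ∧ Q x} = 2 * Nat.card {a : PosI N // Q a.1} := by
  have e : Bool × {a : PosI N // Q a.1} ≃ {x : ℤ // x ≠ 0 ∧ |x| ≤ (N : ℤ) ∧ Q x} := by
    refine Equiv.ofBijective (fun z => ⟨if z.1 then z.2.1.1 else - z.2.1.1, ?_⟩) ⟨?_, ?_⟩
    · obtain ⟨b, ⟨a, ha⟩, hq⟩ := z
      have h := abs_of_pos ha.1
      cases b
      · simpa [h, ha.2, ha.1.ne', hQ] using hq
      · simpa [h, ha.2, ha.1.ne'] using hq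
    · rintro ⟨b, ⟨a, ha⟩, hq⟩ ⟨b', ⟨a', ha'⟩, hq'⟩ h
      cases b <;> cases b' <;> simp at h ⊢ <;> omega
    · rintro ⟨x, h0, h1, h2⟩
      rw [abs_le] at h1
      rcases lt_or_gt_of_ne h0 with h | h
      · exact ⟨(false, ⟨⟨-x, by omega, by omega⟩, (hQ x).2 h2⟩), by simp⟩
      · exact ⟨(true, ⟨⟨x, by omega, by omega⟩, h2⟩), by simp⟩
  rw [← Nat.card_congr e, Nat.card_prod]; simp

abbrev XX (N p m : ℕ) : Type :=
  {π : Equiv.Perm ℤ //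
        (∀ x : ℤ, π (-x) = -π x) ∧ π * π = 1 ∧
        (∀ x : ℤ, ¬(x ≠ 0 ∧ |x| ≤ (N : ℤ)) → π x = x) ∧
        Nat.card {x : ℤ // x ≠ 0 ∧ |x| ≤ (N : ℤ) ∧ π x = x} = 2 * p ∧
        Nat.card {x : ℤ // x ≠ 0 ∧ |x| ≤ (N : ℤ) ∧ π x = -x} = 2 * m}

theorem card_fix (N : ℕ) (π : Equiv.Perm ℤ) (g : PosI N → PosI N) (s : PosI N → Bool)
    (hodd : ∀ x : ℤ, π (-x) = -π x)
    (h : ∀ a : PosI N, π a.1 = if s a then (g a).1 else -(g a).1) :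
    Nat.card {x : ℤ // x ≠ 0 ∧ |x| ≤ (N : ℤ) ∧ π x = x}
      = 2 * Nat.card {a : PosI N // g a = a ∧ s a = true} ∧
    Nat.card {x : ℤ // x ≠ 0 ∧ |x| ≤ (N : ℤ) ∧ π x = -x}
      = 2 * Nat.card {a : PosI N // g a = a ∧ s a = false} := by
  rw [card_double N (fun x => π x = x) (by intro x; simp [hodd]),
    card_double N (fun x => π x = -x) (by intro x; rw [hodd]; exact neg_inj)]
  constructor
  · congr 1
    refine Nat.card_congr (Equiv.subtypeEquivRight ?_)
    intro a
    have h1 := a.2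
    have h2 := (g a).2
    rw [h, Subtype.ext_iff]
    cases s a <;> simp <;> omega
  · congr 1
    refine Nat.card_congr (Equiv.subtypeEquivRight ?_)
    intro a
    have h1 := a.2
    have h2 := (g a).2
    rw [h, Subtype.ext_iff]
    cases s a <;> simp <;> omega

theorem XX_range {N : ℕ} (π : Equiv.Perm ℤ) (hinv : π * π = 1)
    (hs : ∀ x : ℤ, ¬(x ≠ 0 ∧ |x| ≤ (N : ℤ)) → π x = x) (a : PosI N) :
    0 < |π a.1| ∧ |π a.1| ≤ (N : ℤ) := by
  have : π a.1 ≠ 0 ∧ |π a.1| ≤ (N : ℤ) := by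
    by_contra hc
    have h1 := hs _ hc
    have h2 := π.injective h1
    rw [h2] at hc
    exact hc ⟨a.2.1.ne', by rw [abs_of_pos a.2.1]; exact a.2.2⟩
  exact ⟨abs_pos.2 this.1, this.2⟩

def gX {N p m : ℕ} (z : XX N p m) (a : PosI N) : PosI N :=
  ⟨|z.1 a.1|, XX_range z.1 z.2.2.1 z.2.2.2.1 a⟩

def sX {N p m : ℕ} (z : XX N p m) (a : PosI N) : Bool := decide (0 < z.1 a.1)

theorem gsX {N p m : ℕ} (z : XX N p m) (a : PosI N) :
    z.1 a.1 = if sX z a then (gX z a).1 else -(gX z a).1 := by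
  by_cases h : 0 < z.1 a.1
  · simp [sX, gX, h, abs_of_pos h]
  · simp [sX, gX, h, abs_of_nonpos (not_lt.1 h)]

def XtoY {N p m : ℕ} (z : XX N p m) : SInv (PosI N) p m := by
  refine ⟨(gX z, sX z), ?_⟩
  have hz : ∀ x, z.1 (z.1 x) = x := fun x => by
    have := congrArg (fun q : Equiv.Perm ℤ => q x) z.2.2.1
    simpa using this
  have hodd := z.2.1
  refine ⟨?_, ?_, ?_, ?_⟩
  · intro a
    apply Subtype.ext
    change |z.1 (|z.1 a.1|)| = a.1
    rcases abs_choice (z.1 a.1) with h | h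
    · rw [h, hz, abs_of_pos a.2.1]
    · rw [h, hodd, hz, abs_neg, abs_of_pos a.2.1]
  · intro a
    change decide (0 < z.1 (|z.1 a.1|)) = decide (0 < z.1 a.1)
    have ha := a.2.1
    have hr := abs_pos.1 (XX_range z.1 z.2.2.1 z.2.2.2.1 a).1
    rcases lt_or_gt_of_ne hr with h | h
    · rw [abs_of_neg h, hodd, hz]
      simp; omega
    · rw [abs_of_pos h, hz]
      simp; omega
  · have := (card_fix N z.1 (gX z) (sX z) hodd (gsX z)).1
    have h2 := z.2.2.2.2.1
    change Nat.card {a : PosI N // gX z a = a ∧ sX z a = true} = p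
    omega
  · have := (card_fix N z.1 (gX z) (sX z) hodd (gsX z)).2
    have h2 := z.2.2.2.2.2
    change Nat.card {a : PosI N // gX z a = a ∧ sX z a = false} = m
    omega

theorem XtoY_inj {N p m : ℕ} : Function.Injective (XtoY : XX N p m → _) := by
  intro z z' h
  have hg : gX z = gX z' := congrArg (fun y : SInv (PosI N) p m => y.1.1) h
  have hs : sX z = sX z' := congrArg (fun y : SInv (PosI N) p m => y.1.2) h
  have key : ∀ a : PosI N, z.1 a.1 = z'.1 a.1 := fun a => by rw [gsX, gsX, hg, hs]
  apply Subtype.ext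
  apply Equiv.ext
  intro x
  by_cases hx : x ≠ 0 ∧ |x| ≤ (N : ℤ)
  · obtain ⟨h0, h1⟩ := hx
    rw [abs_le] at h1
    rcases lt_or_gt_of_ne h0 with h | h
    · have := key ⟨-x, by omega, by omega⟩
      simp only at this
      rw [z.2.1, z'.2.1] at this
      exact neg_inj.1 this
    · exact key ⟨x, by omega, by omega⟩
  · rw [z.2.2.2.1 x hx, z'.2.2.2.1 x hx]

def backF {N : ℕ} (g : PosI N → PosI N) (s : PosI N → Bool) (x : ℤ) : ℤ :=
  if h : 0 < x ∧ x ≤ (N : ℤ) then (if s ⟨x, h⟩ then (g ⟨x, h⟩).1 else -(g ⟨x, h⟩).1)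
  else if h : 0 < -x ∧ -x ≤ (N : ℤ) then
    (if s ⟨-x, h⟩ then -(g ⟨-x, h⟩).1 else (g ⟨-x, h⟩).1)
  else x

theorem backF_pos {N : ℕ} (g : PosI N → PosI N) (s : PosI N → Bool) (a : PosI N) :
    backF g s a.1 = if s a then (g a).1 else -(g a).1 := by
  rw [backF, dif_pos a.2]

theorem backF_neg {N : ℕ} (g : PosI N → PosI N) (s : PosI N → Bool) (a : PosI N) :
    backF g s (-a.1) = -backF g s a.1 := by
  rw [backF_pos, backF, dif_neg (by have := a.2; omega)]
  have h : (0 < - -a.1 ∧ - -a.1 ≤ (N : ℤ)) := by have := a.2; omega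
  rw [dif_pos h]
  have h' : (⟨- -a.1, h⟩ : PosI N) = a := Subtype.ext (neg_neg _)
  rw [h']
  cases s a <;> simp

theorem backF_out {N : ℕ} (g : PosI N → PosI N) (s : PosI N → Bool) (x : ℤ)
    (hx : ¬(x ≠ 0 ∧ |x| ≤ (N : ℤ))) : backF g s x = x := by
  rw [abs_le] at hx
  rw [backF, dif_neg (by omega), dif_neg (by omega)]

theorem tri_cases (N : ℕ) (x : ℤ) : (∃ a : PosI N, x = a.1) ∨ (∃ a : PosI N, x = -a.1) ∨
    ¬(x ≠ 0 ∧ |x| ≤ (N : ℤ)) := by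
  by_cases hx : x ≠ 0 ∧ |x| ≤ (N : ℤ)
  · obtain ⟨h0, h1⟩ := hx
    rw [abs_le] at h1
    rcases lt_or_gt_of_ne h0 with h | h
    · exact Or.inr (Or.inl ⟨⟨-x, by omega, by omega⟩, by simp⟩)
    · exact Or.inl ⟨⟨x, by omega, by omega⟩, rfl⟩
  · exact Or.inr (Or.inr hx)

theorem backF_odd {N : ℕ} (g : PosI N → PosI N) (s : PosI N → Bool) (x : ℤ) :
    backF g s (-x) = -backF g s x := by
  rcases tri_cases N x with ⟨a, rfl⟩ | ⟨a, rfl⟩ | h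
  · exact backF_neg g s a
  · rw [neg_neg, backF_neg, neg_neg]
  · rw [backF_out g s x h, backF_out g s (-x) (by simpa using h)]

theorem backF_inv {N : ℕ} (g : PosI N → PosI N) (s : PosI N → Bool)
    (hg : ∀ a, g (g a) = a) (hs : ∀ a, s (g a) = s a) :
    Function.Involutive (backF g s) := by
  have key : ∀ a : PosI N, backF g s (backF g s a.1) = a.1 := by
    intro a
    rw [backF_pos]
    cases h : s a
    · simp only [Bool.false_eq_true, if_false]
      rw [backF_neg, backF_pos, hs, h, hg]; simp
    · simp only [if_true]
      rw [backF_pos, hs, h, hg]; simp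
  intro x
  rcases tri_cases N x with ⟨a, rfl⟩ | ⟨a, rfl⟩ | h
  · exact key a
  · rw [backF_odd, backF_odd, key]
  · rw [backF_out g s x h, backF_out g s x h]

theorem XtoY_surj {N p m : ℕ} : Function.Surjective (XtoY : XX N p m → _) := by
  rintro ⟨⟨g, s⟩, hg, hs, hp, hm⟩
  simp only at hg hs hp hm
  let π : Equiv.Perm ℤ := (backF_inv g s hg hs).toPerm
  have hπ : ∀ a : PosI N, π a.1 = if s a then (g a).1 else -(g a).1 := backF_pos g s
  have hc := card_fix N π g s (backF_odd g s) hπ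
  rw [hp, hm] at hc
  refine ⟨⟨π, backF_odd g s, ?_, backF_out g s, hc.1, hc.2⟩, ?_⟩
  · ext x
    exact backF_inv g s hg hs x
  · apply Subtype.ext
    apply Prod.ext
    · funext a
      apply Subtype.ext
      change |π a.1| = (g a).1
      rw [hπ]
      have := (g a).2.1
      cases s a <;> simp [abs_of_pos this]
    · funext a
      change decide (0 < π a.1) = s a
      rw [hπ]
      have := (g a).2.1
      cases s a <;> simp <;> omega

theorem stmt15 (n mp mm : ℕ) :
    Nat.card {π : Equiv.Perm ℤ //
        (∀ x : ℤ, π (-x) = -π x) ∧ π * π = 1 ∧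
        (∀ x : ℤ, ¬(x ≠ 0 ∧ |x| ≤ (2 * n + mp + mm : ℤ)) → π x = x) ∧
        Nat.card {x : ℤ // x ≠ 0 ∧ |x| ≤ (2 * n + mp + mm : ℤ) ∧ π x = x} = 2 * mp ∧
        Nat.card {x : ℤ // x ≠ 0 ∧ |x| ≤ (2 * n + mp + mm : ℤ) ∧ π x = -x} = 2 * mm}
      = (2 * n + mp + mm)! / (n ! * mp ! * mm !) := by
  have hN : (2 * n + mp + mm : ℤ) = ((2 * n + mp + mm : ℕ) : ℤ) := by push_cast; ring
  rw [hN]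
  have h1 : Nat.card (XX (2 * n + mp + mm) mp mm) = Nat.card (SInv (PosI (2 * n + mp + mm)) mp mm) :=
    Nat.card_congr (Equiv.ofBijective XtoY ⟨XtoY_inj, XtoY_surj⟩)
  have h2 := card_SInv (α := PosI (2 * n + mp + mm)) n mp mm (card_PosI _)
  refine h1.trans ?_
  rw [← h2, Nat.mul_div_cancel]
  positivity
end
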